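/- Let w be a squarefree finite word over Σ₄ = {0,1,2,3} such that for every subword x of w with |x| ≥ 2, the reversal x^R is not a subword of w. Then |w| ≤ 20. -/

import Mathlib

namespace SearchProof

/-- Equality test for letters. -/
def eqb (a b : Fin 4) : Bool := Nat.beq a.1 b.1

/-- Prefix test. -/
def isPre : List (Fin 4) → List (Fin 4) → Bool
  | [], _ => true
  | _ :: _, [] => false
  | a :: x, b :: y => eqb a b && isPre x y

/-- Is there a square prefix of `acc ++ rest` whose half strictly extends `acc`? -/
def sq : List (Fin 4) → List (Fin 4) → Bool
  | _, [] => false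
  | acc, a :: r => isPre (acc ++ [a]) r || sq (acc ++ [a]) r

/-- Does the factor `ab` occur? -/
def hasPair (a b : Fin 4) : List (Fin 4) → Bool
  | [] => false
  | [_] => false
  | c :: d :: r => (eqb a c && eqb b d) || hasPair a b (d :: r)

/-- Does the first pair occur reversed? -/
def revBad : List (Fin 4) → Bool
  | a :: b :: r => hasPair b a (a :: b :: r)
  | _ => false

/-- A word rejected by the search. -/
def bad (w : List (Fin 4)) : Bool := revBad w || sq [] w

/-- Exhaustive search: every left extension by `n` letters is rejected. -/
def search : ℕ → List (Fin 4) → Bool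
  | 0, _ => false
  | n + 1, w =>
    ((bad (0 :: w) || search n (0 :: w)) && (bad (1 :: w) || search n (1 :: w))) &&
    ((bad (2 :: w) || search n (2 :: w)) && (bad (3 :: w) || search n (3 :: w)))

/-- The hypotheses of the theorem. -/
def Good (w : List (Fin 4)) : Prop :=
  (∀ x : List (Fin 4), x ≠ [] → ¬ (x ++ x) <:+: w) ∧
  (∀ x : List (Fin 4), x <:+: w → 2 ≤ x.length → ¬ x.reverse <:+: w)

theorem eqb_eq {a b : Fin 4} (h : eqb a b = true) : a = b :=
  Fin.ext (Nat.eq_of_beq_eq_true h)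

theorem isPre_prefix : ∀ {x y : List (Fin 4)}, isPre x y = true → x <+: y
  | [], _, _ => List.nil_prefix
  | _ :: _, [], h => by simp [isPre] at h
  | a :: x, b :: y, h => by
    simp only [isPre, Bool.and_eq_true] at h
    rw [eqb_eq h.1]
    exact (List.prefix_cons_inj b).2 (isPre_prefix h.2)

theorem sq_square : ∀ {acc r : List (Fin 4)}, sq acc r = true →
    ∃ x : List (Fin 4), x ≠ [] ∧ (x ++ x) <+: acc ++ r
  | _, [], h => by simp [sq] at h
  | acc, a :: r, h => by
    simp only [sq, Bool.or_eq_true] at h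
    rcases h with h | h
    · obtain ⟨t, ht⟩ := isPre_prefix h
      exact ⟨acc ++ [a], by simp, t, by rw [← ht]; simp⟩
    · obtain ⟨x, hx, hp⟩ := sq_square h
      exact ⟨x, hx, by simpa using hp⟩

theorem hasPair_infix {a b : Fin 4} : ∀ {w : List (Fin 4)}, hasPair a b w = true → [a, b] <:+: w
  | [], h => by simp [hasPair] at h
  | [_], h => by simp [hasPair] at h
  | c :: d :: r, h => by
    simp only [hasPair, Bool.or_eq_true, Bool.and_eq_true] at h
    rcases h with h | h
    · rw [eqb_eq h.1, eqb_eq h.2]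
      exact ⟨[], r, rfl⟩
    · exact (hasPair_infix h).trans (List.suffix_cons _ _).isInfix

theorem Good.not_bad {w : List (Fin 4)} (hw : Good w) : ¬ bad w = true := by
  intro h
  simp only [bad, Bool.or_eq_true] at h
  rcases h with h | h
  · match w, h, hw with
    | [], h, _ => simp [revBad] at h
    | [_], h, _ => simp [revBad] at h
    | a :: b :: r, h, hw =>
      exact hw.2 [a, b] ⟨[], r, rfl⟩ (by simp) (by simpa using hasPair_infix h)
  · obtain ⟨x, hx, hp⟩ := sq_square h
    exact hw.1 x hx (by simpa using hp.isInfix)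

theorem Good.mono {v w : List (Fin 4)} (hw : Good w) (h : v <:+: w) : Good v :=
  ⟨fun x hx hi => hw.1 x hx (hi.trans h),
   fun x hx hl hi => hw.2 x (hx.trans h) hl (hi.trans h)⟩

theorem search_sound : ∀ (n : ℕ) (w u : List (Fin 4)), search n w = true → Good (u ++ w) →
    u.length < n
  | 0, _, _, h, _ => by simp [search] at h
  | n + 1, w, u, h, hg => by
    rcases List.eq_nil_or_concat u with rfl | ⟨u, a, rfl⟩
    · simp
    · have hg' : Good (u ++ a :: w) := by simpa using hg
      have hb := (hg'.mono (List.suffix_append u (a :: w)).isInfix).not_bad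
      simp only [search, Bool.and_eq_true, Bool.or_eq_true] at h
      have hs : search n (a :: w) = true := by
        obtain ⟨⟨h0, h1⟩, h2, h3⟩ := h
        fin_cases a
        · exact h0.resolve_left hb
        · exact h1.resolve_left hb
        · exact h2.resolve_left hb
        · exact h3.resolve_left hb
      have := search_sound n (a :: w) u hs hg'
      simpa using this

set_option maxRecDepth 100000 in
theorem search_true : search 21 [] = true := by decide +kernel

end SearchProof


/-- A squarefree word over a 4-letter alphabet in which no subword of length ≥ 2 has its
reversal also occurring has length at most 20. -/
theorem stmt_16 (w : List (Fin 4))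
    (hsf : ∀ x : List (Fin 4), x ≠ [] → ¬ (x ++ x) <:+: w)
    (hw : ∀ x : List (Fin 4), x <:+: w → 2 ≤ x.length → ¬ x.reverse <:+: w) :
    w.length ≤ 20 := by
  have := SearchProof.search_sound 21 [] w SearchProof.search_true ⟨by simpa using hsf, by simpa using hw⟩
  omega
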